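/- (Validity of diagonal bias functions for the SSNM.) Consider the SSNM, fix x₀ ∈ X_S and k ∈ {1,…,N}. Let (m_l)_{l∈ℕ} be real coefficients such that for every t ∈ ℝ the series Σ_{l≥0} (m_l/l!)·t^l converges absolutely, and define the diagonal mean function γ : X_S → ℝ by γ(x) = Σ_{l≥0} (m_l/l!)·(x_k − (x₀)_k)^l. Then there exists a Borel function ĝ : ℝ^N → ℝ with ∫ ĝ² dP_{x₀} < ∞ that is P_x-integrable with ∫ ĝ dP_x = γ(x) for every x ∈ X_S if and only if Σ_{l≥0} m_l² σ^{2l}/l! < ∞. -/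

import Mathlib

open MeasureTheory ProbabilityTheory

/-- The distribution `P_x` of `y = x + n` where `n` has i.i.d. `N(0,σ²)` entries
(sparse signal in noise model, SSNM). -/
noncomputable def ssnmP {N : ℕ} (σ : ℝ) (x : Fin N → ℝ) : Measure (Fin N → ℝ) :=
  Measure.map (fun n => x + n)
    (Measure.pi fun _ : Fin N => gaussianReal 0 ((σ ^ 2).toNNReal))

/-- The set `X_S` of `S`-sparse parameter vectors. -/
def sparseSet (N S : ℕ) : Set (Fin N → ℝ) := {x | (Function.support x).ncard ≤ S}

/-- Mean function `γ_ĝ(x) = ∫ ĝ dP_x` of an estimator. -/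
noncomputable def ssnmMean {N : ℕ} (σ : ℝ) (g : (Fin N → ℝ) → ℝ) (x : Fin N → ℝ) : ℝ :=
  ∫ y, g y ∂ ssnmP σ x

/-- Variance `v(ĝ;x) = ∫ (ĝ(y) − γ_ĝ(x))² dP_x(y)` of an estimator. -/
noncomputable def ssnmVar {N : ℕ} (σ : ℝ) (g : (Fin N → ℝ) → ℝ) (x : Fin N → ℝ) : ℝ :=
  ∫ y, (g y - ssnmMean σ g x) ^ 2 ∂ ssnmP σ x


open scoped NNReal ENNReal

theorem exists_inner_eq_of_gram_eq {ι H₁ H₂ : Type*} [NormedAddCommGroup H₁]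
    [InnerProductSpace ℝ H₁] [CompleteSpace H₁] [NormedAddCommGroup H₂] [InnerProductSpace ℝ H₂]
    (e : ι → H₁) (f : ι → H₂) (hef : ∀ i j, inner ℝ (e i) (e j) = inner ℝ (f i) (f j)) (h : H₂) :
    ∃ v : H₁, ∀ i, inner ℝ v (e i) = inner ℝ h (f i) := by
  let A := Finsupp.linearCombination ℝ e
  let B := Finsupp.linearCombination ℝ f
  have hAB : ∀ c, ‖B c‖ = ‖A c‖ := fun c => by
    rw [norm_eq_sqrt_real_inner, norm_eq_sqrt_real_inner]
    simp only [A, B, Finsupp.linearCombination_apply, Finsupp.sum, sum_inner, inner_sum, hef,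
      inner_smul_left, inner_smul_right]
  let φ : (ι →₀ ℝ) →ₗ[ℝ] ℝ := (innerSL ℝ h).toLinearMap ∘ₗ B
  have hφ : ∃ C : ℝ, ∀ c, ‖φ c‖ ≤ C * ‖A c‖ :=
    ⟨‖h‖, fun c => by rw [← hAB]; exact norm_inner_le_norm h (B c)⟩
  obtain ⟨ψ, hψ, -⟩ := exists_extension_norm_eq _ (φ.compLeftInverse A)
  refine ⟨(InnerProductSpace.toDual ℝ H₁).symm ψ, fun i => ?_⟩
  rw [InnerProductSpace.toDual_symm_apply]
  have hi : A (Finsupp.single i 1) = e i := by simp [A]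
  have := hψ ⟨e i, ⟨_, hi⟩⟩
  rw [LinearMap.compLeftInverse_apply_of_bdd _ _ hφ _ _ hi] at this
  simpa [φ, B] using this

theorem eq_of_forall_hasSum_pow {a b : ℕ → ℝ} {F : ℝ → ℝ}
    (ha : ∀ t, HasSum (fun l => a l * t ^ l) (F t))
    (hb : ∀ t, HasSum (fun l => b l * t ^ l) (F t)) :
    a = b := by
  have key : ∀ c : ℕ → ℝ, (∀ t, HasSum (fun l => c l * t ^ l) (F t)) →
      HasFPowerSeriesAt F (FormalMultilinearSeries.ofScalars ℝ c) 0 := fun c hc => by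
    rw [hasFPowerSeriesAt_iff]
    refine Filter.Eventually.of_forall fun z => ?_
    simpa [FormalMultilinearSeries.coeff_ofScalars, mul_comm] using hc z
  have h := (key a ha).eq_formalMultilinearSeries (key b hb)
  ext l
  simpa [FormalMultilinearSeries.coeff_ofScalars] using congrArg (fun p => p.coeff l) h

theorem memℓp_two_pow_div_sqrt_factorial (t : ℝ) :
    Memℓp (fun l : ℕ => t ^ l / √(l.factorial : ℝ)) 2 := by
  rw [memℓp_gen_iff (by norm_num)]
  have := Real.summable_pow_div_factorial (t ^ 2)
  refine this.congr fun l => ?_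
  simp only [ENNReal.toReal_ofNat, Real.rpow_ofNat, Real.norm_eq_abs, sq_abs]
  rw [div_pow, Real.sq_sqrt (by positivity), pow_right_comm]

/-- The feature vector `(t ^ l / √l!)` of the exponential kernel `exp (s t)`. -/
noncomputable def expFeature (t : ℝ) : lp (fun _ : ℕ => ℝ) 2 :=
  ⟨_, memℓp_two_pow_div_sqrt_factorial t⟩

theorem inner_expFeature_left (v : lp (fun _ : ℕ => ℝ) 2) (t : ℝ) :
    HasSum (fun l => v l / √(l.factorial : ℝ) * t ^ l) (inner ℝ v (expFeature t)) := by
  refine (congrArg (HasSum · _) (funext fun l => ?_)).mp (lp.hasSum_inner v (expFeature t))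
  simp only [expFeature, Real.inner_apply]
  ring

theorem inner_expFeature (s t : ℝ) :
    inner ℝ (expFeature s) (expFeature t) = Real.exp (s * t) := by
  refine (inner_expFeature_left _ t).unique ?_
  have := NormedSpace.expSeries_div_hasSum_exp (s * t)
  rw [← Real.exp_eq_exp_ℝ] at this
  refine (congrArg (HasSum · _) (funext fun l => ?_)).mpr this
  have h : √(l.factorial : ℝ) ^ 2 = l.factorial := Real.sq_sqrt (by positivity)
  change s ^ l / √(l.factorial : ℝ) / √(l.factorial : ℝ) * t ^ l = _
  rw [div_div, ← sq, h]
  ring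

theorem gaussianReal_eq_withDensity (a b : ℝ) {v : ℝ≥0} (hv : v ≠ 0) :
    gaussianReal b v = (gaussianReal a v).withDensity fun y =>
      ENNReal.ofReal (Real.exp ((b - a) * (y - a) / v - (b - a) ^ 2 / (2 * v))) := by
  rw [gaussianReal_of_var_ne_zero _ hv, gaussianReal_of_var_ne_zero _ hv,
    ← withDensity_mul _ (measurable_gaussianPDF _ _) (by fun_prop)]
  congr 1
  ext y
  rw [Pi.mul_apply, gaussianPDF, gaussianPDF, ← ENNReal.ofReal_mul (gaussianPDFReal_nonneg _ _ _)]
  congr 1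
  rw [gaussianPDFReal, gaussianPDFReal, mul_assoc (√_)⁻¹, ← Real.exp_add]
  have : (v : ℝ) ≠ 0 := by exact_mod_cast hv
  congr 2
  field_simp
  ring

theorem MeasureTheory.Measure.pi_withDensity_ofReal {ι : Type*} [Fintype ι] {X : ι → Type*}
    [∀ i, MeasurableSpace (X i)] (μ : ∀ i, Measure (X i)) [∀ i, SigmaFinite (μ i)]
    (q : ∀ i, X i → ℝ) (hq : ∀ i, Integrable (q i) (μ i)) (h0 : ∀ i, 0 ≤ q i) :
    Measure.pi (fun i => (μ i).withDensity fun y => ENNReal.ofReal (q i y)) =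
      (Measure.pi μ).withDensity fun y => ENNReal.ofReal (∏ i, q i (y i)) := by
  have : ∀ i, SigmaFinite ((μ i).withDensity fun y => ENNReal.ofReal (q i y)) := fun i =>
    SigmaFinite.withDensity_ofReal _
  refine Measure.pi_eq fun s hs => ?_
  have h1 : ∀ i, ((μ i).withDensity fun y => ENNReal.ofReal (q i y)) (s i) =
      ENNReal.ofReal (∫ y, (s i).indicator (q i) y ∂ μ i) := fun i => by
    rw [withDensity_apply _ (hs i), integral_indicator (hs i),
      ofReal_integral_eq_lintegral_ofReal (hq i).integrableOn (.of_forall (h0 i))]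
  simp_rw [h1]
  rw [← ENNReal.ofReal_prod_of_nonneg fun i _ =>
      integral_nonneg fun y => Set.indicator_nonneg (fun y _ => h0 i y) y,
    ← integral_fintype_prod_eq_prod, ofReal_integral_eq_lintegral_ofReal,
    withDensity_apply _ (MeasurableSet.univ_pi hs),
    ← lintegral_indicator (MeasurableSet.univ_pi hs)]
  · congr 1
    ext y
    by_cases hy : y ∈ Set.univ.pi s
    · rw [Set.indicator_of_mem hy]
      congr 2
      ext i
      rw [Set.indicator_of_mem (hy i trivial)]
    · rw [Set.indicator_of_notMem hy]
      obtain ⟨i, hi⟩ : ∃ i, y i ∉ s i := by simpa [Set.mem_pi] using hy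
      rw [Finset.prod_eq_zero (Finset.mem_univ i) (Set.indicator_of_notMem hi _),
        ENNReal.ofReal_zero]
  · exact Integrable.fintype_prod_dep fun i => (hq i).indicator (hs i)
  · exact .of_forall fun y => Finset.prod_nonneg fun i _ =>
      Set.indicator_nonneg (fun y _ => h0 i y) _

theorem integrable_of_isFiniteMeasure_withDensity_ofReal {Ω : Type*} [MeasurableSpace Ω]
    {μ : Measure Ω} {q : Ω → ℝ} (hq : AEStronglyMeasurable q μ) (h0 : 0 ≤ q)
    [IsFiniteMeasure (μ.withDensity fun y => ENNReal.ofReal (q y))] : Integrable q μ := by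
  refine ⟨hq, ?_⟩
  rw [hasFiniteIntegral_iff_ofReal (.of_forall h0)]
  have := measure_lt_top (μ.withDensity fun y => ENNReal.ofReal (q y)) Set.univ
  rwa [withDensity_apply _ .univ, setLIntegral_univ] at this

theorem ssnmP_eq_pi {N : ℕ} (σ : ℝ) (x : Fin N → ℝ) :
    ssnmP σ x = Measure.pi fun i => gaussianReal (x i) (σ ^ 2).toNNReal := by
  have := Measure.pi_map_pi (μ := fun _ : Fin N => gaussianReal 0 (σ ^ 2).toNNReal)
    (f := fun i n => x i + n) (fun i => by fun_prop)
  simp_rw [gaussianReal_map_const_add, zero_add] at this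
  exact this.symm ▸ rfl

instance {N : ℕ} (σ : ℝ) (x : Fin N → ℝ) : IsProbabilityMeasure (ssnmP σ x) := by
  rw [ssnmP_eq_pi]; infer_instance

theorem ssnmP_map_eval {N : ℕ} (σ : ℝ) (x : Fin N → ℝ) (k : Fin N) :
    (ssnmP σ x).map (fun y (_ : Fin 1) => y k) = ssnmP σ fun _ => x k := by
  rw [ssnmP_eq_pi, ssnmP_eq_pi]
  have h1 := measurePreserving_eval (fun i => gaussianReal (x i) (σ ^ 2).toNNReal) k
  have h2 := (measurePreserving_funUnique (gaussianReal (x k) (σ ^ 2).toNNReal) (Fin 1)).symm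
  exact (h2.comp h1).map_eq

/-- The likelihood ratio of `P_x` with respect to `P_{x₀}` in the SSNM. -/
noncomputable def ssnmLikelihoodRatio {N : ℕ} (σ : ℝ) (x₀ x y : Fin N → ℝ) : ℝ :=
  Real.exp (∑ i, ((x i - x₀ i) * (y i - x₀ i) / σ ^ 2 - (x i - x₀ i) ^ 2 / (2 * σ ^ 2)))

section LikelihoodRatio

variable {N : ℕ} {σ : ℝ} (x₀ x x' : Fin N → ℝ)

theorem measurable_ssnmLikelihoodRatio : Measurable (ssnmLikelihoodRatio σ x₀ x) := by
  unfold ssnmLikelihoodRatio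
  fun_prop

theorem ssnmP_eq_withDensity (hσ : 0 < σ) :
    ssnmP σ x = (ssnmP σ x₀).withDensity fun y =>
      ENNReal.ofReal (ssnmLikelihoodRatio σ x₀ x y) := by
  have hv : (σ ^ 2).toNNReal ≠ 0 := by simpa using hσ.ne'
  have hv' : ((σ ^ 2).toNNReal : ℝ) = σ ^ 2 := Real.coe_toNNReal _ (sq_nonneg σ)
  have h := fun i => gaussianReal_eq_withDensity (x₀ i) (x i) hv
  simp_rw [hv'] at h
  rw [ssnmP_eq_pi, ssnmP_eq_pi, funext h, Measure.pi_withDensity_ofReal]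
  · simp_rw [← Real.exp_sum]
    rfl
  · intro i
    have : IsFiniteMeasure (gaussianReal (x i) (σ ^ 2).toNNReal) := inferInstance
    rw [h i] at this
    exact integrable_of_isFiniteMeasure_withDensity_ofReal
      (Measurable.aestronglyMeasurable (by fun_prop)) fun y => (Real.exp_pos _).le
  · exact fun i y => (Real.exp_pos _).le

theorem ssnmLikelihoodRatio_nonneg : 0 ≤ ssnmLikelihoodRatio σ x₀ x :=
  fun _ => (Real.exp_pos _).le

theorem integrable_ssnmLikelihoodRatio (hσ : 0 < σ) :
    Integrable (ssnmLikelihoodRatio σ x₀ x) (ssnmP σ x₀) := by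
  have : IsFiniteMeasure ((ssnmP σ x₀).withDensity fun y =>
      ENNReal.ofReal (ssnmLikelihoodRatio σ x₀ x y)) := by
    rw [← ssnmP_eq_withDensity x₀ x hσ]
    infer_instance
  exact integrable_of_isFiniteMeasure_withDensity_ofReal
    (measurable_ssnmLikelihoodRatio x₀ x).aestronglyMeasurable (ssnmLikelihoodRatio_nonneg x₀ x)

theorem integral_ssnmP (hσ : 0 < σ) (g : (Fin N → ℝ) → ℝ) :
    ∫ y, g y ∂ssnmP σ x = ∫ y, ssnmLikelihoodRatio σ x₀ x y * g y ∂ssnmP σ x₀ := by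
  rw [ssnmP_eq_withDensity x₀ x hσ, integral_withDensity_eq_integral_toReal_smul
    (measurable_ssnmLikelihoodRatio x₀ x).ennreal_ofReal
    (.of_forall fun _ => ENNReal.ofReal_lt_top)]
  simp_rw [ENNReal.toReal_ofReal (ssnmLikelihoodRatio_nonneg x₀ x _), smul_eq_mul]

theorem ssnmLikelihoodRatio_mul (y : Fin N → ℝ) :
    ssnmLikelihoodRatio σ x₀ x y * ssnmLikelihoodRatio σ x₀ x' y =
      Real.exp (∑ i, (x i - x₀ i) * (x' i - x₀ i) / σ ^ 2) *
        ssnmLikelihoodRatio σ x₀ (x + x' - x₀) y := by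
  simp only [ssnmLikelihoodRatio, ← Real.exp_add, ← Finset.sum_add_distrib]
  congr 2
  ext i
  simp only [Pi.add_apply, Pi.sub_apply]
  ring

theorem memLp_ssnmLikelihoodRatio (hσ : 0 < σ) :
    MemLp (ssnmLikelihoodRatio σ x₀ x) 2 (ssnmP σ x₀) := by
  rw [memLp_two_iff_integrable_sq (measurable_ssnmLikelihoodRatio x₀ x).aestronglyMeasurable]
  simp_rw [sq, ssnmLikelihoodRatio_mul]
  exact (integrable_ssnmLikelihoodRatio x₀ _ hσ).const_mul _

theorem integrable_ssnmP_of_memLp_two (hσ : 0 < σ) {g : (Fin N → ℝ) → ℝ}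
    (hg : MemLp g 2 (ssnmP σ x₀)) : Integrable g (ssnmP σ x) := by
  rw [ssnmP_eq_withDensity x₀ x hσ, integrable_withDensity_iff_integrable_smul'
    (measurable_ssnmLikelihoodRatio x₀ x).ennreal_ofReal
    (.of_forall fun _ => ENNReal.ofReal_lt_top)]
  simp_rw [ENNReal.toReal_ofReal (ssnmLikelihoodRatio_nonneg x₀ x _)]
  exact (memLp_ssnmLikelihoodRatio x₀ x hσ).integrable_mul hg

theorem inner_toLp_ssnmLikelihoodRatio (hσ : 0 < σ) (u : Lp ℝ 2 (ssnmP σ x₀)) :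
    inner ℝ u (memLp_ssnmLikelihoodRatio x₀ x hσ).toLp = ∫ y, u y ∂ssnmP σ x := by
  rw [L2.inner_def, integral_ssnmP x₀ x hσ]
  refine integral_congr_ae ?_
  filter_upwards [(memLp_ssnmLikelihoodRatio x₀ x hσ).coeFn_toLp] with y hy
  simp [hy]

theorem integral_ssnmP_congr_ae (hσ : 0 < σ) {f g : (Fin N → ℝ) → ℝ} (h : f =ᵐ[ssnmP σ x₀] g) :
    ∫ y, f y ∂ssnmP σ x = ∫ y, g y ∂ssnmP σ x := by
  refine integral_congr_ae ?_
  rw [ssnmP_eq_withDensity x₀ x hσ]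
  exact (withDensity_absolutelyContinuous _ _).ae_eq h

theorem inner_ssnmLikelihoodRatio (hσ : 0 < σ) :
    inner ℝ (memLp_ssnmLikelihoodRatio x₀ x hσ).toLp (memLp_ssnmLikelihoodRatio x₀ x' hσ).toLp =
      Real.exp (∑ i, (x i - x₀ i) * (x' i - x₀ i) / σ ^ 2) := by
  rw [inner_toLp_ssnmLikelihoodRatio _ _ hσ, integral_ssnmP_congr_ae x₀ x' hσ (MemLp.coeFn_toLp _),
    integral_ssnmP x₀ x' hσ]
  have h := integral_ssnmP x₀ (x' + x - x₀) hσ fun _ => 1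
  simp only [mul_one, integral_const, probReal_univ, smul_eq_mul] at h
  simp_rw [ssnmLikelihoodRatio_mul, integral_const_mul, ← h, mul_one, mul_comm (x _ - x₀ _)]

end LikelihoodRatio

theorem summable_of_integral_ssnmP_single {N : ℕ} {σ : ℝ} (hσ : 0 < σ) (k : Fin N)
    (x₀ : Fin N → ℝ) {m : ℕ → ℝ} {g : (Fin N → ℝ) → ℝ} (hg : MemLp g 2 (ssnmP σ x₀))
    (h : ∀ t, HasSum (fun l : ℕ => m l / (l.factorial : ℝ) * (t - x₀ k) ^ l)
      (∫ y, g y ∂ssnmP σ (Pi.single k t))) :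
    Summable fun l : ℕ => m l ^ 2 * σ ^ (2 * l) / (l.factorial : ℝ) := by
  set C := Real.exp (∑ i ∈ Finset.univ.erase k, x₀ i ^ 2 / σ ^ 2) with hC
  have hCs : √C ^ 2 = C := Real.sq_sqrt (Real.exp_pos _).le
  obtain ⟨v, hv⟩ := exists_inner_eq_of_gram_eq
    (fun t => √C • expFeature ((t - x₀ k) / σ))
    (fun t : ℝ => (memLp_ssnmLikelihoodRatio x₀ (Pi.single k t) hσ).toLp)
    (fun s t => by
      rw [inner_ssnmLikelihoodRatio _ _ _ hσ, inner_smul_left, inner_smul_right, inner_expFeature,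
        ← mul_assoc, conj_trivial, ← sq, hCs, hC, ← Real.exp_add,
        ← Finset.sum_erase_add _ _ (Finset.mem_univ k)]
      congr 2
      · refine Finset.sum_congr rfl fun i hi => ?_
        simp [Pi.single_eq_of_ne (Finset.ne_of_mem_erase hi), sq]
      · simp
        ring) hg.toLp
  have hF : ∀ t, inner ℝ v (√C • expFeature (t / σ)) =
      ∫ y, g y ∂ssnmP σ (Pi.single k (t + x₀ k)) := fun t => by
    have := hv (t + x₀ k)
    rw [inner_toLp_ssnmLikelihoodRatio _ _ hσ, integral_ssnmP_congr_ae x₀ _ hσ hg.coeFn_toLp] at this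
    simpa using this
  have hm := eq_of_forall_hasSum_pow (fun t => by simpa using h (t + x₀ k))
    (b := fun l => √C * (v l / √(l.factorial : ℝ)) / σ ^ l) fun t => by
      rw [← hF, inner_smul_right]
      refine (congrArg (HasSum · _) (funext fun l => ?_)).mpr ((inner_expFeature_left v (t / σ)).mul_left √C)
      rw [div_pow]
      ring
  have hv2 := (lp.memℓp v).summable (by norm_num)
  refine (hv2.mul_left C).congr fun l => ?_
  have hl : √(l.factorial : ℝ) ^ 2 = l.factorial := Real.sq_sqrt (by positivity)
  have hl0 : √(l.factorial : ℝ) ≠ 0 := by positivity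
  have hml : m l = √C * v l * √(l.factorial : ℝ) / σ ^ l := by
    have := congrFun hm l
    rw [div_eq_iff (by positivity)] at this
    rw [this]
    nth_rewrite 2 [← hl]
    field_simp
  rw [hml]
  simp only [ENNReal.toReal_ofNat, Real.rpow_ofNat, Real.norm_eq_abs, sq_abs]
  rw [div_pow, mul_pow, mul_pow, hl, hCs, pow_mul', div_mul_cancel₀ _ (by positivity),
    mul_div_cancel_right₀ _ (by positivity)]

theorem exists_integral_ssnmP_one_eq {σ : ℝ} (hσ : 0 < σ) (c : ℝ) {m : ℕ → ℝ}
    (hm : Summable fun l : ℕ => m l ^ 2 * σ ^ (2 * l) / (l.factorial : ℝ)) :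
    ∃ g : (Fin 1 → ℝ) → ℝ, Measurable g ∧ MemLp g 2 (ssnmP σ fun _ => c) ∧
      ∀ t, ∫ y, g y ∂ssnmP σ (fun _ => t) = ∑' l : ℕ, m l / (l.factorial : ℝ) * (t - c) ^ l := by
  have hw : Memℓp (fun l : ℕ => m l * σ ^ l / √(l.factorial : ℝ)) 2 := by
    rw [memℓp_gen_iff (by norm_num)]
    refine hm.congr fun l => ?_
    simp only [ENNReal.toReal_ofNat, Real.rpow_ofNat, Real.norm_eq_abs, sq_abs]
    rw [div_pow, mul_pow, Real.sq_sqrt (by positivity), pow_mul']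
  obtain ⟨u, hu⟩ := exists_inner_eq_of_gram_eq
    (fun t : ℝ => (memLp_ssnmLikelihoodRatio (fun _ : Fin 1 => c) (fun _ => t) hσ).toLp)
    (fun t => expFeature ((t - c) / σ))
    (fun s t => by
      rw [inner_ssnmLikelihoodRatio _ _ _ hσ, inner_expFeature]
      simp
      ring) ⟨_, hw⟩
  refine ⟨u, (Lp.stronglyMeasurable u).measurable, Lp.memLp u, fun t => ?_⟩
  rw [← inner_toLp_ssnmLikelihoodRatio (fun _ : Fin 1 => c) _ hσ, hu,
    ← (inner_expFeature_left _ _).tsum_eq]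
  refine tsum_congr fun l => ?_
  change m l * σ ^ l / √(l.factorial : ℝ) / √(l.factorial : ℝ) * _ = _
  rw [div_div, ← sq, Real.sq_sqrt (by positivity), div_pow]
  field_simp

/-- Validity of diagonal bias functions for the SSNM. For a diagonal
mean function `γ(x) = Σ_{l≥0} (m_l/l!)(x_k − (x₀)_k)^l` (with everywhere absolutely
convergent series), there is an estimator with finite variance at `x₀` whose mean on
`X_S` equals `γ` if and only if `Σ_{l≥0} m_l² σ^{2l}/l! < ∞`. -/
theorem ssnm_diagonal_bias_valid_iff {N S : ℕ} (hN : 1 ≤ N) (hS1 : 1 ≤ S) (hSN : S ≤ N)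
    (σ : ℝ) (hσ : 0 < σ) (k : Fin N)
    (x₀ : Fin N → ℝ) (hx₀ : x₀ ∈ sparseSet N S)
    (m : ℕ → ℝ)
    (hconv : ∀ t : ℝ, Summable (fun l => |m l / (l.factorial : ℝ) * t ^ l|))
    (γ : (Fin N → ℝ) → ℝ)
    (hγ : ∀ x, γ x = ∑' l : ℕ, m l / (l.factorial : ℝ) * (x k - x₀ k) ^ l) :
    (∃ g : (Fin N → ℝ) → ℝ, Measurable g ∧
        Integrable (fun y => g y ^ 2) (ssnmP σ x₀) ∧
        ∀ x ∈ sparseSet N S, Integrable g (ssnmP σ x) ∧ (∫ y, g y ∂ ssnmP σ x) = γ x)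
      ↔ Summable (fun l : ℕ => m l ^ 2 * σ ^ (2 * l) / (l.factorial : ℝ)) := by
  constructor
  · rintro ⟨g, hgm, hg2, hg⟩
    refine summable_of_integral_ssnmP_single hσ k x₀
      ((memLp_two_iff_integrable_sq hgm.aestronglyMeasurable).2 hg2) fun t => ?_
    have ht : Pi.single k t ∈ sparseSet N S :=
      ((Set.ncard_le_ncard Pi.support_single_subset (Set.finite_singleton k)).trans
        (Set.ncard_singleton k).le).trans hS1
    rw [(hg _ ht).2, hγ, Pi.single_eq_same]
    exact (hconv _).of_abs.hasSum
  · intro hm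
    obtain ⟨g, hgm, hg2, hg⟩ := exists_integral_ssnmP_one_eq hσ (x₀ k) hm
    have hk : Measurable fun (y : Fin N → ℝ) (_ : Fin 1) => y k := by fun_prop
    have hmp : ∀ x : Fin N → ℝ, MeasurePreserving (fun y (_ : Fin 1) => y k) (ssnmP σ x)
        (ssnmP σ fun _ => x k) := fun x => ⟨hk, ssnmP_map_eval σ x k⟩
    have hL : MemLp (fun y : Fin N → ℝ => g fun _ => y k) 2 (ssnmP σ x₀) :=
      hg2.comp_measurePreserving (hmp x₀)
    refine ⟨fun y => g fun _ => y k, hgm.comp hk, hL.integrable_sq, fun x _ =>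
      ⟨integrable_ssnmP_of_memLp_two x₀ x hσ hL, ?_⟩⟩
    rw [hγ, ← hg, ← ssnmP_map_eval σ x k,
      integral_map hk.aemeasurable hgm.aestronglyMeasurable]
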